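/- For every integer k ≥ 3, zero is an accumulation point of the set Γ^{(k)} = {γ(F) : F a k-uniform hypergraph}; that is, for every ε > 0 there exists a k-uniform hypergraph F with γ(F) ∈ (0, ε). -/

import Mathlib

open Finset

open scoped Classical

/-- The degree of a set of vertices `s` in the edge set `E`: the number of edges containing `s`. -/
noncomputable def hdeg {α : Type*} [DecidableEq α] (E : Finset (Finset α)) (s : Finset α) : ℕ :=
  (E.filter fun e => s ⊆ e).card

/-- The hypergraph with edge set `F` (on vertex type `α`) has a copy inside the hypergraph with
edge set `E` (on vertex type `β`). -/
def HasCopy {α β : Type*} [DecidableEq β] (F : Finset (Finset α)) (E : Finset (Finset β)) :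
    Prop :=
  ∃ f : α → β, Function.Injective f ∧ ∀ e ∈ F, e.image f ∈ E

/-- The codegree Turán number `exco k n F`: the largest `d` such that some `F`-free `k`-uniform
hypergraph on `n` vertices has minimum codegree at least `d`. -/
noncomputable def exco {α : Type*} (k n : ℕ) (F : Finset (Finset α)) : ℕ :=
  sSup {d : ℕ | ∃ E : Finset (Finset (Fin n)), (∀ e ∈ E, e.card = k) ∧ ¬ HasCopy F E ∧
    ∀ s : Finset (Fin n), s.card = k - 1 → d ≤ hdeg E s}

/-- The codegree Turán density `γ(F)`. -/
noncomputable def codegTuranDensity {α : Type*} (k : ℕ) (F : Finset (Finset α)) : ℝ :=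
  Filter.limsup (fun n : ℕ => (exco k n F : ℝ) / n) Filter.atTop

/-- The `k`-uniform zycle of length `ℓ`: vertices are pairs `(i, j)` with `i ∈ Fin ℓ`,
`j ∈ Fin (k-1)`; for each `i, j` there is an edge `{(i, 1), …, (i, k-1), (i+1, j)}`
(first coordinate taken modulo `ℓ`). -/
def zycle (k ℓ : ℕ) : Finset (Finset (Fin ℓ × Fin (k - 1))) :=
  Finset.univ.image fun p : Fin ℓ × Fin (k - 1) =>
    insert (⟨(p.1.val + 1) % ℓ, Nat.mod_lt _ p.1.pos⟩, p.2)
      (Finset.univ.image fun j : Fin (k - 1) => (p.1, j))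

/-- `e ▷ f` : every extension of `e` by a vertex of `f` is an edge. -/
def Tri {α : Type*} [DecidableEq α] (E : Finset (Finset α)) (e f : Finset α) : Prop :=
  ∀ v ∈ f, insert v e ∈ E

theorem pow_mul_card_le_sum_pow {ι : Type*} [Fintype ι] (f : ι → ℝ) (b : ℝ) (p : ℕ) (hp : 0 < p)
    (hf : ∀ i, 0 ≤ f i) (hb : 0 ≤ b) (hle : b * Fintype.card ι ≤ ∑ i, f i) :
    b ^ p * Fintype.card ι ≤ ∑ i, f i ^ p := by
  obtain ⟨p, rfl⟩ := Nat.exists_eq_succ_of_ne_zero hp.ne'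
  refine le_trans ?_ (pow_sum_div_card_le_sum_pow (s := (univ : Finset ι)) (f := f)
    (fun i _ => hf i) p)
  rcases Nat.eq_zero_or_pos (Fintype.card ι) with h0 | h0
  · simp only [h0, Nat.cast_zero, mul_zero]
    exact div_nonneg (pow_nonneg (sum_nonneg fun i _ => hf i) _) (by positivity)
  have h0' : (0 : ℝ) < Fintype.card ι := by exact_mod_cast h0
  rw [card_univ, le_div_iff₀ (by positivity)]
  calc _ = (b * Fintype.card ι) ^ (p + 1) := by rw [Nat.succ_eq_add_one]; ring
    _ ≤ _ := by gcongr

/-- If a set of `g`-tuples has density at least `c`, then its `m`-fold blow-up has density at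
least `c ^ m ^ g`. -/
theorem card_blowup_ge {X : Type*} [Fintype X] [Nonempty X] (m : ℕ) (hm : 0 < m) (g : ℕ) :
    ∀ (S : (Fin g → X) → Prop) (c : ℝ), 0 ≤ c →
      c * (Fintype.card X : ℝ) ^ g ≤ #{x | S x} →
      c ^ m ^ g * ((Fintype.card X : ℝ) ^ m) ^ g ≤
        #{y : Fin g → Fin m → X | ∀ φ : Fin g → Fin m, S fun i => y i (φ i)} := by
  have hN : (0 : ℝ) < Fintype.card X := by exact_mod_cast Fintype.card_pos
  induction g with
  | zero =>
    intro S c hc h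
    refine le_trans (by simpa using h) ?_
    norm_cast
    refine card_le_card_of_injOn (fun _ i => i.elim0) ?_ ?_
    · intro x hx
      rw [mem_coe, mem_filter] at hx ⊢
      refine ⟨mem_univ _, fun φ => ?_⟩
      rw [Subsingleton.elim (fun i : Fin 0 => (i.elim0 : Fin m → X) (φ i)) x]
      exact hx.2
    · intro x _ y _ _
      exact Subsingleton.elim _ _
  | succ g ih =>
    intro S c hc h
    set N : ℝ := ((Fintype.card X : ℕ) : ℝ) with hNdef
    obtain ⟨T, hTdef⟩ : ∃ T : (Fin m → X) → (Fin g → X) → Prop,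
        ∀ a z, T a z ↔ ∀ t, S (Fin.cons (a t) z) := ⟨_, fun _ _ => Iff.rfl⟩
    let d : (Fin g → X) → ℝ := fun z => #{x | S (Fin.cons x z)}
    have hsum : (#{x | S x} : ℝ) = ∑ z, d z := by
      simp only [d]
      norm_cast
      simp only [card_filter]
      rw [← Equiv.sum_comp (Fin.consEquiv fun _ => X), Fintype.sum_prod_type_right]
      rfl
    have hT : ∑ a, (#{z | T a z} : ℝ) = ∑ z, d z ^ m := by
      simp only [d]
      norm_cast
      simp only [card_filter]
      rw [sum_comm]
      refine sum_congr rfl fun z _ => ?_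
      rw [← card_filter, ← card_filter, ← Fintype.card_piFinset_const]
      refine congrArg card ?_
      ext a
      simp [hTdef, Fintype.mem_piFinset]
    have hgoal : (#{y : Fin (g + 1) → Fin m → X | ∀ φ : Fin (g + 1) → Fin m,
        S fun i => y i (φ i)} : ℝ) = ∑ a : Fin m → X,
          (#{w : Fin g → Fin m → X | ∀ φ : Fin g → Fin m, T a fun i => w i (φ i)} : ℝ) := by
      norm_cast
      simp only [card_filter]
      rw [← Equiv.sum_comp (Fin.consEquiv fun _ => Fin m → X), Fintype.sum_prod_type]
      refine sum_congr rfl fun a _ => sum_congr rfl fun w _ => ?_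
      congr 1
      simp only [hTdef, eq_iff_iff]
      constructor
      · intro H φ t
        convert H (Fin.cons t φ) using 1
        ext i
        refine Fin.cases ?_ (fun i => ?_) i <;> simp [Fin.consEquiv]
      · intro H φ
        convert H (fun i => φ i.succ) (φ 0) using 1
        ext i
        refine Fin.cases ?_ (fun i => ?_) i <;> simp [Fin.consEquiv]
    have h2 := pow_mul_card_le_sum_pow d (c * N) m hm (fun z => by positivity) (by positivity) (by
      rw [← hsum]; refine le_trans (le_of_eq ?_) h
      simp [Fintype.card_pi, hNdef]; ring)
    rw [← hT] at h2
    have h3 := pow_mul_card_le_sum_pow (fun a => (#{z | T a z} : ℝ) / N ^ g) (c ^ m) (m ^ g) (by positivity)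
      (fun z => by positivity) (by positivity) (by
        rw [← sum_div, le_div_iff₀ (by positivity)]
        refine le_trans (le_of_eq ?_) h2
        simp [Fintype.card_pi, hNdef]; ring)
    rw [hgoal]
    calc _ = (c ^ m) ^ m ^ g * (Fintype.card (Fin m → X) : ℝ) * (N ^ m) ^ g := by
          rw [Fintype.card_pi_const, Nat.cast_pow, ← hNdef, ← pow_mul c, ← pow_succ' m,
            mul_assoc, ← pow_succ' (N ^ m)]
      _ ≤ (∑ a, ((#{z | T a z} : ℝ) / N ^ g) ^ m ^ g) * (N ^ m) ^ g :=
          mul_le_mul_of_nonneg_right h3 (by positivity)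
      _ = ∑ a, ((#{z | T a z} : ℝ) / N ^ g) ^ m ^ g * (N ^ m) ^ g := by rw [sum_mul]
      _ ≤ _ := by
        refine sum_le_sum fun a _ => ?_
        have hdens : (#{z | T a z} : ℝ) / N ^ g * N ^ g ≤ #{z | T a z} :=
          (div_mul_cancel₀ _ (by positivity)).le
        exact ih (T a) _ (by positivity) hdens

/-- If `R` has out-density at least `δ`, then with probability at least `1 / 2` every entry of a
random `(r + 1)`-tuple is related to another entry. -/
theorem card_forall_exists_rel_ge {X : Type*} [Fintype X] (R : X → X → Prop) (δ : ℝ)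
    (hR : ∀ x, δ * Fintype.card X ≤ #{y | R x y}) (r : ℕ)
    (hr : (r + 1) * (1 - δ) ^ r ≤ 1 / 2) :
    1 / 2 * (Fintype.card X : ℝ) ^ (r + 1) ≤
      #{x : Fin (r + 1) → X | ∀ i, ∃ j, j ≠ i ∧ R (x i) (x j)} := by
  set N : ℝ := ((Fintype.card X : ℕ) : ℝ) with hNdef
  have hbad : ∀ i : Fin (r + 1), (#{x : Fin (r + 1) → X | ∀ j, j ≠ i → ¬ R (x i) (x j)} : ℝ) ≤
      (1 - δ) ^ r * N ^ (r + 1) := by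
    intro i
    have : (#{x : Fin (r + 1) → X | ∀ j, j ≠ i → ¬ R (x i) (x j)} : ℝ) =
        ∑ a, (#{y | ¬ R a y} : ℝ) ^ r := by
      norm_cast
      rw [card_filter, ← Equiv.sum_comp (Fin.insertNthEquiv (fun _ => X) i),
        Fintype.sum_prod_type]
      refine sum_congr rfl fun a _ => ?_
      rw [← card_filter, ← Fintype.card_piFinset_const]
      congr 1
      ext z
      simp only [Fin.insertNthEquiv_apply, Fin.forall_iff_succAbove i, Fintype.mem_piFinset,
        mem_filter, mem_univ, true_and, Fin.insertNth_apply_same, Fin.insertNth_apply_succAbove]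
      simp
    rw [this]
    calc _ ≤ ∑ a : X, ((1 - δ) * N) ^ r := by
          refine sum_le_sum fun a _ => ?_
          gcongr
          have h1 := card_filter_add_card_filter_not (s := (univ : Finset X)) (fun y => R a y)
          have h2 : (#{y | R a y} : ℝ) + #{y | ¬ R a y} = N := by
            rw [hNdef, ← card_univ]; exact_mod_cast h1
          linarith [hR a]
      _ = _ := by simp [← hNdef, mul_pow]; ring
  have hcover : (univ : Finset (Fin (r + 1) → X)) ⊆
      ({x : Fin (r + 1) → X | ∀ i, ∃ j, j ≠ i ∧ R (x i) (x j)} : Finset _) ∪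
      univ.biUnion fun i => ({x : Fin (r + 1) → X | ∀ j, j ≠ i → ¬ R (x i) (x j)} : Finset _) := by
    intro x _
    simp only [mem_union, mem_filter, mem_univ, true_and, mem_biUnion]
    by_contra! h
    obtain ⟨⟨i, hi⟩, h2⟩ := h
    obtain ⟨j, hj, hj'⟩ := h2 i
    exact hi j hj hj'
  have h1 : (N ^ (r + 1) : ℝ) ≤ #{x : Fin (r + 1) → X | ∀ i, ∃ j, j ≠ i ∧ R (x i) (x j)} +
      ∑ i : Fin (r + 1), (#{x : Fin (r + 1) → X | ∀ j, j ≠ i → ¬ R (x i) (x j)} : ℝ) := by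
    have := (card_le_card hcover).trans (card_union_le _ _)
    have h3 := this.trans (Nat.add_le_add_left card_biUnion_le _)
    rw [card_univ, Fintype.card_pi_const] at h3
    rw [hNdef]
    exact_mod_cast h3
  have h2 := h1.trans (add_le_add_right (sum_le_sum fun i _ => hbad i) _)
  simp only [sum_const, card_univ, Fintype.card_fin, nsmul_eq_mul] at h2
  push_cast at h2
  have h4 : (r + 1) * (1 - δ) ^ r * N ^ (r + 1) ≤ 1 / 2 * N ^ (r + 1) := by gcongr
  linarith

/-- Pigeonhole: a fixed choice `τ` of out-neighbours works for a positive fraction of tuples. -/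
theorem exists_selfmap_card_ge {X : Type*} [Fintype X] [Nonempty X] (R : X → X → Prop) (s : ℕ)
    (hs : 0 < s) (c : ℝ) (hc : 0 < c)
    (h : c * (Fintype.card X : ℝ) ^ s ≤ #{x : Fin s → X | ∀ i, ∃ j, j ≠ i ∧ R (x i) (x j)}) :
    ∃ τ : Fin s → Fin s, (∀ i, τ i ≠ i) ∧
      c / (s : ℝ) ^ s * (Fintype.card X : ℝ) ^ s ≤ #{x : Fin s → X | ∀ i, R (x i) (x (τ i))} := by
  have hN : (0 : ℝ) < Fintype.card X := by exact_mod_cast Fintype.card_pos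
  have hs' : (0 : ℝ) < s := by exact_mod_cast hs
  have : Nonempty (Fin s) := ⟨⟨0, hs⟩⟩
  have hex : ∀ x : Fin s → X, ∃ τ : Fin s → Fin s,
      (∀ i, ∃ j, j ≠ i ∧ R (x i) (x j)) → ∀ i, τ i ≠ i ∧ R (x i) (x (τ i)) := by
    intro x
    by_cases hx : ∀ i, ∃ j, j ≠ i ∧ R (x i) (x j)
    · choose τ hτ using hx
      exact ⟨τ, fun _ => hτ⟩
    · exact ⟨id, fun h => absurd h hx⟩
  choose f hf using hex
  obtain ⟨τ, -, hτ⟩ := exists_le_card_fiber_of_nsmul_le_card_of_maps_to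
    (s := ({x : Fin s → X | ∀ i, ∃ j, j ≠ i ∧ R (x i) (x j)} : Finset _))
    (t := (univ : Finset (Fin s → Fin s))) (f := f)
    (b := c / (s : ℝ) ^ s * (Fintype.card X : ℝ) ^ s)
    (fun _ _ => mem_univ _) univ_nonempty (by
      refine le_trans (le_of_eq ?_) h
      simp; field_simp)
  refine ⟨τ, ?_, hτ.trans ?_⟩
  · have hpos : (0 : ℝ) < c / (s : ℝ) ^ s * (Fintype.card X : ℝ) ^ s := by positivity
    have := hpos.trans_le hτ
    norm_cast at this
    obtain ⟨x, hx⟩ := card_pos.1 this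
    simp only [mem_filter, mem_univ, true_and] at hx
    intro i
    rw [← hx.2]
    exact (hf x hx.1 i).1
  · norm_cast
    refine card_le_card fun x hx => ?_
    simp only [mem_filter, mem_univ, true_and] at hx ⊢
    intro i
    rw [← hx.2]
    exact (hf x hx.1 i).2

theorem exists_iterate_factorial_eq {s : ℕ} (hs : 0 < s) (τ : Fin s → Fin s) :
    ∃ i, τ^[s.factorial] i = i := by
  have : Nonempty (Fin s) := ⟨⟨0, hs⟩⟩
  obtain ⟨i⟩ := this
  obtain ⟨a, b, hab, h⟩ := Fintype.exists_ne_map_eq_of_card_lt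
    (fun t : Fin (s + 1) => τ^[t.val] i) (by simp)
  wlog hlt : a < b generalizing a b
  · exact this b a hab.symm h.symm (lt_of_le_of_ne (not_lt.1 hlt) hab.symm)
  refine ⟨τ^[a.val] i, ?_⟩
  have hper : Function.IsPeriodicPt τ (b.val - a.val) (τ^[a.val] i) := by
    unfold Function.IsPeriodicPt Function.IsFixedPt
    rw [← Function.iterate_add_apply, Nat.sub_add_cancel (by exact hlt.le)]
    exact h.symm
  exact hper.trans_dvd (Nat.dvd_factorial (Nat.sub_pos_of_lt hlt) (by omega))

theorem hdeg_eq_card_extensions {α : Type*} [Fintype α] [DecidableEq α] {k : ℕ} (hk : 1 ≤ k)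
    {E : Finset (Finset α)} (hE : ∀ e ∈ E, e.card = k) {s : Finset α} (hs : s.card = k - 1) :
    hdeg E s = #{v | insert v s ∈ E} := by
  have hns : ∀ v, insert v s ∈ E → v ∉ s := by
    intro v hv hvs
    have := hE _ hv
    rw [insert_eq_of_mem hvs] at this
    omega
  symm
  refine card_bij (fun v _ => insert v s) ?_ ?_ ?_
  · intro v hv
    simp only [mem_filter, mem_univ, true_and] at hv ⊢
    exact ⟨hv, subset_insert _ _⟩
  · intro v hv w hw h
    simp only [mem_filter, mem_univ, true_and] at hv hw
    have : v ∈ insert w s := h ▸ mem_insert_self v s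
    exact (mem_insert.1 this).resolve_right (hns v hv)
  · intro e he
    simp only [mem_filter] at he
    have hcard : (e \ s).card = 1 := by
      rw [card_sdiff_of_subset he.2, hE e he.1, hs]
      omega
    obtain ⟨v, hv⟩ := card_eq_one.1 hcard
    have hins : insert v s = e := by
      rw [insert_eq, ← hv, sdiff_union_of_subset he.2]
    exact ⟨v, by simpa [hins] using he.1, hins⟩

theorem exco_div_le {α : Type*} {k n : ℕ} {F : Finset (Finset α)} {c : ℝ} (hc : 0 ≤ c)
    (h : ∀ E : Finset (Finset (Fin n)), (∀ e ∈ E, e.card = k) →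
      (∀ s : Finset (Fin n), s.card = k - 1 → c * n ≤ hdeg E s) → HasCopy F E) :
    (exco k n F : ℝ) / n ≤ c := by
  refine div_le_of_le_mul₀ (Nat.cast_nonneg _) hc ?_
  refine le_trans ?_ (Nat.floor_le (by positivity : 0 ≤ c * n))
  norm_cast
  refine csSup_le' ?_
  rintro d ⟨E, hE, hF, hd⟩
  by_contra! hlt
  refine hF (h E hE fun s hs => ?_)
  exact ((Nat.lt_of_floor_lt hlt).le).trans (by exact_mod_cast hd s hs)

theorem le_exco {α : Type*} {k n d : ℕ} (hn : k - 1 ≤ n) {F : Finset (Finset α)}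
    (E : Finset (Finset (Fin n))) (hE : ∀ e ∈ E, e.card = k) (hF : ¬ HasCopy F E)
    (hd : ∀ s : Finset (Fin n), s.card = k - 1 → d ≤ hdeg E s) : d ≤ exco k n F := by
  refine le_csSup ⟨Fintype.card (Finset (Fin n)), ?_⟩ ⟨E, hE, hF, hd⟩
  rintro d ⟨E, -, -, hd⟩
  obtain ⟨s, -, hs⟩ := exists_subset_card_eq (s := (univ : Finset (Fin n)))
    (n := k - 1) (by rwa [card_univ, Fintype.card_fin])
  exact (hd s hs).trans ((card_filter_le _ _).trans (card_le_univ _))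

theorem codegTuranDensity_mem_Icc {α : Type*} {k : ℕ} {F : Finset (Finset α)} {a b : ℝ}
    (hb : 0 ≤ b)
    (hlow : ∃ᶠ n : ℕ in Filter.atTop, a ≤ (exco k n F : ℝ) / n)
    (hup : ∀ᶠ n : ℕ in Filter.atTop, ∀ E : Finset (Finset (Fin n)), (∀ e ∈ E, e.card = k) →
      (∀ s : Finset (Fin n), s.card = k - 1 → b * n ≤ hdeg E s) → HasCopy F E) :
    codegTuranDensity k F ∈ Set.Icc a b := by
  have hup' : ∀ᶠ n : ℕ in Filter.atTop, (exco k n F : ℝ) / n ≤ b :=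
    hup.mono fun n hn => exco_div_le hb hn
  refine ⟨Filter.le_limsup_of_frequently_le hlow ⟨b, hup'⟩, Filter.limsup_le_of_le ?_ hup'⟩
  exact Filter.isCoboundedUnder_le_of_le Filter.atTop (x := 0) fun n => by positivity

theorem hasCopy_image_iff {α α' β : Type*} [DecidableEq α'] [DecidableEq β] (σ : α ≃ α')
    (F : Finset (Finset α)) (E : Finset (Finset β)) :
    HasCopy (F.image fun e => e.image σ) E ↔ HasCopy F E := by
  constructor
  · rintro ⟨f, hf, h⟩
    refine ⟨f ∘ σ, hf.comp σ.injective, fun e he => ?_⟩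
    rw [← image_image]
    exact h _ (mem_image_of_mem _ he)
  · rintro ⟨f, hf, h⟩
    refine ⟨f ∘ σ.symm, hf.comp σ.symm.injective, fun e he => ?_⟩
    obtain ⟨e', he', rfl⟩ := mem_image.1 he
    simpa [image_image, Function.comp_assoc] using h e' he'

theorem card_of_mem_zycle {k ℓ : ℕ} (hk : 1 ≤ k) (hℓ : 2 ≤ ℓ) {e : Finset (Fin ℓ × Fin (k - 1))}
    (he : e ∈ zycle k ℓ) : e.card = k := by
  obtain ⟨⟨i, j⟩, -, rfl⟩ := mem_image.1 he
  rw [card_insert_of_notMem, card_image_of_injective _ (Prod.mk_right_injective i)]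
  · simp; omega
  · simp only [mem_image, mem_univ, true_and, Prod.mk.injEq, not_exists, not_and]
    intro j' h
    have h1 := congrArg Fin.val h
    simp only at h1
    have := i.isLt
    rcases Nat.lt_or_ge (i.val + 1) ℓ with h2 | h2
    · rw [Nat.mod_eq_of_lt h2] at h1; omega
    · rw [show i.val + 1 = ℓ by omega, Nat.mod_self] at h1; omega

/-- The `k`-sets of vertices whose labels in `ZMod m` sum to `1`. -/
noncomputable def sumOneHypergraph (k m n : ℕ) : Finset (Finset (Fin n)) :=
  {e | e.card = k ∧ ∑ v ∈ e, ((v.val : ℕ) : ZMod m) = 1}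

theorem le_hdeg_sumOneHypergraph {k m q : ℕ} (hk : 1 ≤ k) (hm : 0 < m)
    {s : Finset (Fin (m * q))} (hs : s.card = k - 1) :
    q - (k - 1) ≤ hdeg (sumOneHypergraph k m (m * q)) s := by
  have : NeZero m := ⟨hm.ne'⟩
  rw [hdeg_eq_card_extensions hk (fun e he => (mem_filter.1 he).2.1) hs]
  set a : ZMod m := 1 - ∑ v ∈ s, ((v.val : ℕ) : ZMod m)
  have hq : q ≤ #{v : Fin (m * q) | ((v.val : ℕ) : ZMod m) = a} := by
    have hlt : ∀ t : Fin q, a.val + m * t.val < m * q := fun t => by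
      have h1 := ZMod.val_lt a
      have h2 : m * (t.val + 1) ≤ m * q := Nat.mul_le_mul_left _ t.isLt
      rw [mul_add] at h2
      omega
    calc q = #(univ : Finset (Fin q)) := by simp
      _ ≤ _ := card_le_card_of_injOn (fun t => ⟨a.val + m * t.val, hlt t⟩) (by
        intro t _
        rw [mem_coe, mem_filter]
        simp) (by
        intro t _ t' _ h
        simp only [Fin.mk.injEq, Nat.add_left_cancel_iff, mul_eq_mul_left_iff] at h
        exact Fin.ext (h.resolve_right hm.ne'))
  have hsub : ({v : Fin (m * q) | ((v.val : ℕ) : ZMod m) = a} : Finset _) \ s ⊆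
      ({v | insert v s ∈ sumOneHypergraph k m (m * q)} : Finset _) := by
    intro v hv
    simp only [mem_sdiff, mem_filter, mem_univ, true_and] at hv
    simp only [sumOneHypergraph, mem_filter, mem_univ, true_and, card_insert_of_notMem hv.2,
      sum_insert hv.2, hv.1, hs, a]
    exact ⟨by omega, by ring⟩
  have h1 := le_card_sdiff s ({v : Fin (m * q) | ((v.val : ℕ) : ZMod m) = a} : Finset _)
  have h2 := card_le_card hsub
  omega

theorem exists_sumOneHypergraph_zycle_free {k ℓ : ℕ} (hk : 3 ≤ k) (hℓ : 2 ≤ ℓ) :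
    ∃ m, 0 < m ∧ ∀ n, ¬ HasCopy (zycle k ℓ) (sumOneHypergraph k m n) := by
  set r : ℤ := 1 - k with hr
  set M : ℤ := ∑ j ∈ range ℓ, r ^ j with hM
  have hgeom : M * (r - 1) = r ^ ℓ - 1 := geom_sum_mul r ℓ
  have hM0 : M ≠ 0 := by
    intro h0
    have h1 : r ^ ℓ = 1 := by rw [h0] at hgeom; linarith
    have h2 := congrArg Int.natAbs h1
    rw [Int.natAbs_pow, Int.natAbs_one, Nat.pow_eq_one] at h2
    omega
  have hk0 : (k : ℤ) ≠ 0 := by omega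
  refine ⟨(k * M).natAbs, Int.natAbs_pos.2 (mul_ne_zero hk0 hM0), ?_⟩
  intro n
  set m := (k * M).natAbs with hm
  rintro ⟨f, hf, hfE⟩
  have hpos : 0 < ℓ := by omega
  let lab : Fin n → ZMod m := fun v => ((v.val : ℕ) : ZMod m)
  let S : ℕ → ZMod m := fun t => ∑ j, lab (f (⟨t % ℓ, Nat.mod_lt _ hpos⟩, j))
  have hstep : ∀ t, S (t + 1) = ((k : ZMod m) - 1) + (1 - k) * S t := by
    intro t
    have hlab : ∀ j, lab (f (⟨(t + 1) % ℓ, Nat.mod_lt _ hpos⟩, j)) = 1 - S t := by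
      intro j
      have hmem : _ ∈ zycle k ℓ := mem_image_of_mem _
        (mem_univ ((⟨t % ℓ, Nat.mod_lt _ hpos⟩, j) : Fin ℓ × Fin (k - 1)))
      have hcard := card_of_mem_zycle (by omega) hℓ hmem
      have hE := hfE _ hmem
      have hsum := (mem_filter.1 hE).2.2
      rw [sum_image hf.injOn] at hsum
      have hnot : (⟨(t % ℓ + 1) % ℓ, Nat.mod_lt _ hpos⟩, j) ∉
          univ.image fun j : Fin (k - 1) => ((⟨t % ℓ, Nat.mod_lt _ hpos⟩ : Fin ℓ), j) := by
        intro hin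
        simp only at hcard
        rw [insert_eq_of_mem hin, card_image_of_injective _ (Prod.mk_right_injective _)] at hcard
        simp at hcard
        omega
      simp only at hsum
      rw [sum_insert hnot, sum_image (Prod.mk_right_injective _).injOn] at hsum
      simp only [Nat.mod_add_mod] at hsum
      exact eq_sub_of_add_eq hsum
    simp only [S] at hlab ⊢
    rw [sum_congr rfl fun j _ => hlab j]
    simp only [sum_const, card_univ, Fintype.card_fin, nsmul_eq_mul]
    rw [Nat.cast_sub (by omega)]
    push_cast
    ring
  have hform : ∀ t, S t = (r : ZMod m) ^ t * S 0 +
      (k - 1) * ((∑ j ∈ range t, r ^ j : ℤ) : ZMod m) := by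
    intro t
    induction t with
    | zero => simp
    | succ t ih =>
      rw [hstep, ih, geom_sum_succ, hr]
      push_cast
      ring
  have hkM : (k : ZMod m) * (M : ZMod m) = 0 := by
    have : ((k * M : ℤ) : ZMod m) = 0 := by
      rw [ZMod.intCast_zmod_eq_zero_iff_dvd]
      exact Int.natAbs_dvd.2 dvd_rfl
    exact_mod_cast this
  have hrℓ : (r : ZMod m) ^ ℓ = 1 := by
    have : ((r ^ ℓ : ℤ) : ZMod m) = ((1 - k * M : ℤ) : ZMod m) := by
      congr 1
      rw [hr] at hgeom ⊢
      linear_combination -hgeom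
    push_cast at this
    rw [this, hkM, sub_zero]
  have hcyc : S ℓ = S 0 := by simp [S]
  have h1 := hform ℓ
  rw [hcyc, hrℓ, ← hM] at h1
  have h2 : (M : ZMod m) = 0 := by linear_combination h1 + hkM
  rw [ZMod.intCast_zmod_eq_zero_iff_dvd, hm, Int.natCast_natAbs, abs_dvd] at h2
  obtain ⟨c, hc⟩ := h2
  have h3 : (k : ℤ) * c = 1 := mul_left_cancel₀ hM0 (by linear_combination -hc)
  have h4 := Int.eq_one_or_neg_one_of_mul_eq_one h3
  omega

theorem exists_pos_frequently_le_exco {α : Type*} {k ℓ : ℕ} (hk : 3 ≤ k) (hℓ : 2 ≤ ℓ)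
    (F : Finset (Finset α))
    (hF : ∀ n, ∀ E : Finset (Finset (Fin n)), HasCopy F E → HasCopy (zycle k ℓ) E) :
    ∃ a : ℝ, 0 < a ∧ ∃ᶠ n : ℕ in Filter.atTop, a ≤ (exco k n F : ℝ) / n := by
  obtain ⟨m, hm, hfree⟩ := exists_sumOneHypergraph_zycle_free hk hℓ
  have hm' : (1 : ℝ) ≤ m := by exact_mod_cast hm
  refine ⟨1 / (2 * m), by positivity, ?_⟩
  rw [Filter.frequently_atTop]
  intro n₀
  refine ⟨m * (n₀ + 2 * k), by nlinarith, ?_⟩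
  have h1 : n₀ + 2 * k - (k - 1) ≤ exco k (m * (n₀ + 2 * k)) F :=
    le_exco (by nlinarith [Nat.sub_le k 1]) _ (fun e he => (mem_filter.1 he).2.1)
      (fun h => hfree _ (hF _ _ h)) fun s hs => le_hdeg_sumOneHypergraph (by omega) hm hs
  have h2 : n₀ + 2 * k ≤ 2 * exco k (m * (n₀ + 2 * k)) F := by omega
  have h3 : (n₀ + 2 * k : ℝ) ≤ 2 * exco k (m * (n₀ + 2 * k)) F := by exact_mod_cast h2
  have hk' : (3 : ℝ) ≤ k := by exact_mod_cast hk
  rw [div_le_div_iff₀ (by positivity) (by push_cast; positivity)]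
  push_cast
  nlinarith

theorem card_injective_ge (β : Type*) [Fintype β] {n : ℕ} (hn : 0 < n) :
    (1 - (Fintype.card β : ℝ) ^ 2 / n) * (n : ℝ) ^ Fintype.card β ≤
      #{f : β → Fin n | Function.Injective f} := by
  set a := Fintype.card β with ha
  have hn' : (0 : ℝ) < n := by exact_mod_cast hn
  rcases le_or_gt (a : ℝ) n with han | han
  · have han' : a ≤ n := by exact_mod_cast han
    have hcard : #{f : β → Fin n | Function.Injective f} = n.descFactorial a := by
      rw [← Fintype.card_subtype, Fintype.card_congr (Equiv.subtypeInjectiveEquivEmbedding _ _),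
        Fintype.card_embedding_eq, Fintype.card_fin]
    have h1 : (n - a) ^ a ≤ n.descFactorial a :=
      (Nat.pow_le_pow_left (by omega) _).trans (Nat.pow_sub_le_descFactorial n a)
    have h2 : ((n : ℝ) - a) ^ a ≤ n.descFactorial a := by
      rw [← Nat.cast_sub han']; exact_mod_cast h1
    have h3 := one_add_mul_le_pow (a := -((a : ℝ) / n))
      (by linarith [(div_le_one hn').2 han]) a
    rw [hcard]
    refine le_trans ?_ h2
    calc _ ≤ (1 + -((a : ℝ) / n)) ^ a * (n : ℝ) ^ a := by
          gcongr
          refine le_trans (le_of_eq ?_) h3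
          ring
      _ = _ := by
          rw [← mul_pow]
          congr 1
          field_simp
          ring
  · refine le_trans (mul_nonpos_of_nonpos_of_nonneg ?_ (by positivity)) (Nat.cast_nonneg _)
    rw [sub_nonpos, one_le_div hn']
    have : (1 : ℝ) ≤ n := by exact_mod_cast hn
    nlinarith

/-- A robust blow-up of a functional digraph `τ` among the `(k - 1)`-tuples contains a zycle. -/
theorem hasCopy_zycle_of_blowup {k s n : ℕ} (hs : 0 < s) (E : Finset (Finset (Fin n)))
    (τ : Fin s → Fin s) (hτ : ∀ i, τ i ≠ i)
    (y : Fin s → Fin s.factorial → Fin (k - 1) → Fin n)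
    (hinj : Function.Injective fun p : Fin s × Fin s.factorial × Fin (k - 1) => y p.1 p.2.1 p.2.2)
    (hy : ∀ φ : Fin s → Fin s.factorial, ∀ i, ∀ j,
      insert (y (τ i) (φ (τ i)) j) (univ.image (y i (φ i))) ∈ E) :
    HasCopy (zycle k s.factorial) E := by
  obtain ⟨i₀, hi₀⟩ := exists_iterate_factorial_eq hs τ
  refine ⟨fun p => y (τ^[p.1.val] i₀) p.1 p.2, ?_, ?_⟩
  · rintro ⟨t, j⟩ ⟨t', j'⟩ h
    have := @hinj (τ^[t.val] i₀, t, j) (τ^[t'.val] i₀, t', j') h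
    simp only [Prod.mk.injEq] at this ⊢
    exact this.2
  · intro e he
    obtain ⟨⟨t, j⟩, -, rfl⟩ := mem_image.1 he
    have hper : Function.IsPeriodicPt τ s.factorial i₀ := hi₀
    have hmod : τ^[(t.val + 1) % s.factorial] i₀ = τ (τ^[t.val] i₀) := by
      rw [hper.iterate_mod_apply, Function.iterate_succ_apply']
    rw [image_insert, image_image]
    simp only [hmod]
    have := hy (Function.update (fun _ => ⟨(t.val + 1) % s.factorial, Nat.mod_lt _ t.pos⟩)
      (τ^[t.val] i₀) t) (τ^[t.val] i₀) j
    rw [Function.update_self, Function.update_of_ne (hτ _)] at this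
    exact this

theorem exists_eventually_hasCopy_zycle {k : ℕ} (hk : 1 ≤ k) {ε : ℝ} (hε : 0 < ε) (hε1 : ε ≤ 1) :
    ∃ ℓ, 2 ≤ ℓ ∧ ∀ᶠ n : ℕ in Filter.atTop, ∀ E : Finset (Finset (Fin n)),
      (∀ e ∈ E, e.card = k) → (∀ s : Finset (Fin n), s.card = k - 1 → ε * n ≤ hdeg E s) →
      HasCopy (zycle k ℓ) E := by
  set δ : ℝ := ε ^ (k - 1) with hδ
  have hδ0 : 0 < δ := by positivity
  have hδ1 : δ ≤ 1 := pow_le_one₀ hε.le hε1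
  obtain ⟨r, hr1, hr⟩ : ∃ r : ℕ, 1 ≤ r ∧ ((r : ℝ) + 1) * (1 - δ) ^ r ≤ 1 / 2 := by
    have h1 := tendsto_self_mul_const_pow_of_lt_one (r := 1 - δ) (by linarith) (by linarith)
    have h2 := tendsto_pow_atTop_nhds_zero_of_lt_one (r := 1 - δ) (by linarith) (by linarith)
    have h3 := h1.add h2
    rw [add_zero] at h3
    obtain ⟨r, hr, hr1⟩ := ((h3.eventually_lt_const (by norm_num : (0 : ℝ) < 1 / 2)).and
      (Filter.eventually_ge_atTop 1)).exists
    exact ⟨r, hr1, by linarith⟩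
  set s := r + 1 with hs
  have hs0 : 0 < s := by omega
  set ℓ := s.factorial with hℓ
  have hℓ0 : 0 < ℓ := Nat.factorial_pos s
  refine ⟨ℓ, le_trans (by omega) (Nat.self_le_factorial s), ?_⟩
  set c : ℝ := (1 / 2 / (s : ℝ) ^ s) ^ ℓ ^ s with hc
  have hc0 : 0 < c := by positivity
  set β := Fin s × Fin ℓ × Fin (k - 1) with hβ
  filter_upwards [Filter.eventually_gt_atTop 0,
    Filter.eventually_gt_atTop ⌈(Fintype.card β : ℝ) ^ 2 / c⌉₊] with n hn0 hn E hE hdeg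
  have hn0' : (0 : ℝ) < n := by exact_mod_cast hn0
  have : Nonempty (Fin n) := ⟨⟨0, hn0⟩⟩
  obtain ⟨R, hRdef⟩ : ∃ R : (Fin (k - 1) → Fin n) → (Fin (k - 1) → Fin n) → Prop,
      ∀ x y, R x y ↔ (Function.Injective x → ∀ j, insert (y j) (univ.image x) ∈ E) :=
    ⟨_, fun _ _ => Iff.rfl⟩
  have hR : ∀ x, δ * Fintype.card (Fin (k - 1) → Fin n) ≤ #{y | R x y} := by
    intro x
    rw [Fintype.card_pi_const, Fintype.card_fin]
    by_cases hx : Function.Injective x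
    · have hxc : (univ.image x).card = k - 1 := by
        rw [card_image_of_injective _ hx, card_univ, Fintype.card_fin]
      have h1 := hdeg _ hxc
      rw [hdeg_eq_card_extensions hk hE hxc] at h1
      have h2 : ({y | R x y} : Finset (Fin (k - 1) → Fin n)) =
          Fintype.piFinset fun _ => ({v | insert v (univ.image x) ∈ E} : Finset (Fin n)) := by
        ext y
        simp [hRdef, hx, Fintype.mem_piFinset]
      rw [h2, Fintype.card_piFinset_const, hδ]
      push_cast
      rw [← mul_pow]
      gcongr
    · have h2 : ({y | R x y} : Finset (Fin (k - 1) → Fin n)) = univ := by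
        ext y
        simp [hRdef, hx]
      rw [h2, card_univ, Fintype.card_pi_const, Fintype.card_fin]
      exact mul_le_of_le_one_left (by positivity) hδ1
  obtain ⟨τ, hτ, hcard⟩ := exists_selfmap_card_ge R s hs0 (1 / 2) (by norm_num)
    (card_forall_exists_rel_ge R δ hR r hr)
  have hblow := card_blowup_ge ℓ hℓ0 s (fun x => ∀ i, R (x i) (x (τ i)))
    (1 / 2 / (s : ℝ) ^ s) (by positivity) (by convert hcard)
  set Y₁ : Finset (Fin s → Fin ℓ → Fin (k - 1) → Fin n) :=
    {y | ∀ φ : Fin s → Fin ℓ, ∀ i, R (y i (φ i)) (y (τ i) (φ (τ i)))} with hY₁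
  set Y₂ : Finset (Fin s → Fin ℓ → Fin (k - 1) → Fin n) :=
    {y | Function.Injective fun p : β => y p.1 p.2.1 p.2.2} with hY₂
  have hβcard : Fintype.card β = s * (ℓ * (k - 1)) := by simp [hβ]
  have htotal : (((Fintype.card (Fin (k - 1) → Fin n) : ℕ) : ℝ) ^ ℓ) ^ s =
      (n : ℝ) ^ Fintype.card β := by
    rw [Fintype.card_pi_const, Fintype.card_fin, hβcard]
    push_cast
    rw [← pow_mul, ← pow_mul]
    congr 1
    ring
  have hY₂card : #Y₂ = #{f : β → Fin n | Function.Injective f} := by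
    refine card_bij' (fun y _ p => y p.1 p.2.1 p.2.2) (fun f _ i t j => f (i, t, j)) ?_ ?_ ?_ ?_
    · intro y hy
      simpa [hY₂] using hy
    · intro f hf
      simpa [hY₂] using hf
    · intro y _
      rfl
    · intro f _
      rfl
  have hinj : (1 - (Fintype.card β : ℝ) ^ 2 / n) * (n : ℝ) ^ Fintype.card β ≤ #Y₂ := by
    rw [hY₂card]
    convert card_injective_ge β hn0
  have hsmall : (Fintype.card β : ℝ) ^ 2 / n < c := by
    have h1 : (Fintype.card β : ℝ) ^ 2 / c < n := (Nat.le_ceil _).trans_lt (by exact_mod_cast hn)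
    rw [div_lt_iff₀ hc0] at h1
    rw [div_lt_iff₀ hn0']
    linarith
  have hlt : #(univ : Finset (Fin s → Fin ℓ → Fin (k - 1) → Fin n)) < #Y₁ + #Y₂ := by
    rw [card_univ]
    have h1 : ((Fintype.card (Fin s → Fin ℓ → Fin (k - 1) → Fin n) : ℕ) : ℝ) =
        (n : ℝ) ^ Fintype.card β := by
      rw [← htotal, Fintype.card_pi_const, Fintype.card_pi_const]
      push_cast
      rfl
    have h2 : ((Fintype.card (Fin s → Fin ℓ → Fin (k - 1) → Fin n) : ℕ) : ℝ) <
        (#Y₁ : ℝ) + #Y₂ := by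
      rw [h1]
      rw [htotal] at hblow
      have hpos : (0 : ℝ) < (n : ℝ) ^ Fintype.card β := by positivity
      have hY₁' : c * (n : ℝ) ^ Fintype.card β ≤ #Y₁ := by convert hblow
      nlinarith
    exact_mod_cast h2
  obtain ⟨y, hy⟩ := inter_nonempty_of_card_lt_card_add_card (subset_univ Y₁) (subset_univ Y₂) hlt
  simp only [hY₁, hY₂, mem_inter, mem_filter, mem_univ, true_and] at hy
  obtain ⟨hy1, hy2⟩ := hy
  refine hasCopy_zycle_of_blowup hs0 E τ hτ y hy2 fun φ i j => (hRdef _ _).1 (hy1 φ i) ?_ j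
  intro j j' h
  have := @hy2 (i, φ i, j) (i, φ i, j') h
  exact congrArg (fun p => p.2.2) this

/-- For every integer `k ≥ 3`, zero is an accumulation point of the set
`Γ^{(k)} = {γ(F) : F a k-uniform hypergraph}`; that is, for every `ε > 0` there exists a
`k`-uniform hypergraph `F` with `γ(F) ∈ (0, ε)`. -/
theorem statement1 (k : ℕ) (hk : 3 ≤ k) (ε : ℝ) (hε : 0 < ε) :
    ∃ (m : ℕ) (F : Finset (Finset (Fin m))), (∀ e ∈ F, e.card = k) ∧
      codegTuranDensity k F ∈ Set.Ioo (0 : ℝ) ε := by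
  have hε' : 0 < min (ε / 2) 1 := by positivity
  obtain ⟨ℓ, hℓ, hup⟩ :=
    exists_eventually_hasCopy_zycle (k := k) (by omega) hε' (min_le_right _ _)
  let σ := Fintype.equivFin (Fin ℓ × Fin (k - 1))
  let F := (zycle k ℓ).image fun e => e.image σ
  obtain ⟨a, ha, hlow⟩ := exists_pos_frequently_le_exco hk hℓ F
    fun n E => (hasCopy_image_iff σ (zycle k ℓ) E).1
  have hmem := codegTuranDensity_mem_Icc hε'.le hlow
    (hup.mono fun n hn E hE hd => (hasCopy_image_iff σ (zycle k ℓ) E).2 (hn E hE hd))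
  refine ⟨_, F, ?_, ha.trans_le hmem.1, hmem.2.trans_lt ?_⟩
  · intro e he
    obtain ⟨e', he', rfl⟩ := mem_image.1 he
    rw [card_image_of_injective _ σ.injective]
    exact card_of_mem_zycle (by omega) hℓ he'
  · exact (min_le_left _ _).trans_lt (half_lt_self hε)
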